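/- Let H ⊂ P^N, N ≥ 2, be an irreducible nondegenerate reduced hypersurface of degree d ≥ 3. Then the t-trisecant variety C_H H equals P^N. -/

import Mathlib

open MvPolynomial

/-! Basic projective geometry over ℂ, concretely via `Projectivization`. -/

/-- Projective space of lines in `ℂ^k`. -/
abbrev PrSp (k : ℕ) := Projectivization ℂ (Fin k → ℂ)

/-- Projective `N`-space `ℙ^N` over `ℂ`. -/
abbrev Pr (N : ℕ) := PrSp (N + 1)

namespace ProjGeo

variable {k : ℕ}

/-- The zero locus in projective space of a set of (homogeneous) polynomials. -/
def zeroLocus (S : Set (MvPolynomial (Fin k) ℂ)) : Set (PrSp k) :=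
  {p | ∀ f ∈ S, ∀ v ∈ p.submodule, eval v f = 0}

/-- Zariski-closed subsets of projective space. -/
def IsZClosed (C : Set (PrSp k)) : Prop := ∃ S, C = zeroLocus S

/-- The Zariski closure of a subset of projective space. -/
def projClosure (T : Set (PrSp k)) : Set (PrSp k) :=
  zeroLocus {f | ∀ p ∈ T, ∀ v ∈ p.submodule, eval v f = 0}

/-- A (projective) line in projective space. -/
def IsLine (l : Set (PrSp k)) : Prop :=
  ∃ W : Submodule ℂ (Fin k → ℂ), Module.finrank ℂ W = 2 ∧ l = {p | p.submodule ≤ W}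

/-- The chord (projective line, when `x ≠ y`) through two points. -/
def chord (x y : PrSp k) : Set (PrSp k) := {p | p.submodule ≤ x.submodule ⊔ y.submodule}

/-- The gradient of `f` at `a` as a linear functional on `ℂ^k`. -/
noncomputable def grad (f : MvPolynomial (Fin k) ℂ) (a : Fin k → ℂ) :
    (Fin k → ℂ) →ₗ[ℂ] ℂ :=
  ∑ i, eval a (pderiv i f) • LinearMap.proj i

/-- The (affine) Zariski tangent space at `a ∈ ℂ^k` of the cone cut out by `I`. -/
noncomputable def tangentCone (I : Set (MvPolynomial (Fin k) ℂ)) (a : Fin k → ℂ) :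
    Submodule ℂ (Fin k → ℂ) :=
  ⨅ f ∈ I, LinearMap.ker (grad f a)

/-- The subvariety cut out by `I` is smooth of dimension `n` at the point `x`. -/
def SmoothAt (I : Set (MvPolynomial (Fin k) ℂ)) (n : ℕ) (x : PrSp k) : Prop :=
  ∀ v ∈ x.submodule, v ≠ 0 → Module.finrank ℂ (tangentCone I v) = n + 1

/-- The embedded projective tangent space `T_x X` of the variety cut out by `I` at `x`. -/
noncomputable def embTangent (I : Set (MvPolynomial (Fin k) ℂ)) (x : PrSp k) : Set (PrSp k) :=
  {p | p.submodule ≤ tangentCone I x.rep}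

/-- The tangent variety `Tan(X) = closure of ⋃_{x ∈ X_sm} T_x X`. -/
noncomputable def TanVar (I : Set (MvPolynomial (Fin k) ℂ)) (n : ℕ) : Set (PrSp k) :=
  projClosure (⋃ x ∈ {x ∈ zeroLocus I | SmoothAt I n x}, embTangent I x)

/-- The secant variety `Sec(X)`: closure of the union of chords through pairs of
distinct points of `X`. -/
noncomputable def SecVar (I : Set (MvPolynomial (Fin k) ℂ)) : Set (PrSp k) :=
  projClosure {p | ∃ x ∈ zeroLocus I, ∃ y ∈ zeroLocus I, x ≠ y ∧ p ∈ chord x y}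

/-- Restriction of a polynomial to the (affine cone over the) line `t ↦ a + t b`. -/
noncomputable def lineRestrict (f : MvPolynomial (Fin k) ℂ) (a b : Fin k → ℂ) :
    Polynomial ℂ :=
  eval₂ (Polynomial.C : ℂ →+* Polynomial ℂ)
    (fun i => Polynomial.C (a i) + Polynomial.X * Polynomial.C (b i)) f

/-- Order of vanishing of a one-variable polynomial at `0` (`⊤` for the zero polynomial). -/
noncomputable def vanishingOrder (p : Polynomial ℂ) : ℕ∞ :=
  if p = 0 then ⊤ else (p.rootMultiplicity 0 : ℕ∞)

/-- Intersection multiplicity, at the point `[a]`, of the variety cut out by `I` with the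
line spanned by `a` and `b`. -/
noncomputable def lineMultAt (I : Set (MvPolynomial (Fin k) ℂ)) (a b : Fin k → ℂ) : ℕ∞ :=
  ⨅ f ∈ I, vanishingOrder (lineRestrict f a b)

/-- `C` is a cone with vertex `x`: with every point it contains the whole line through
that point and `x`. -/
def IsConeWithVertex (x : PrSp k) (C : Set (PrSp k)) : Prop :=
  ∀ y ∈ C, chord x y ⊆ C

/-- The chord-cone `C_x Y ⊆ T_x X`: union of the chords joining `x` to the points
`y ≠ x` of `Y ∩ T_x X`. -/
noncomputable def coneAt (I : Set (MvPolynomial (Fin k) ℂ)) (Y : Set (PrSp k))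
    (x : PrSp k) : Set (PrSp k) :=
  ⋃ y ∈ (Y ∩ embTangent I x) \ {x}, chord x y

/-- `C_X Y`: the closure of the union of the cones `C_x Y` over the smooth points `x`
of `X` (the variety of dimension `n` cut out by `I`). For `Y = X` this is the
t-trisecant variety of `X`. -/
noncomputable def CXY (I : Set (MvPolynomial (Fin k) ℂ)) (n : ℕ) (Y : Set (PrSp k)) :
    Set (PrSp k) :=
  projClosure (⋃ x ∈ {x ∈ zeroLocus I | SmoothAt I n x}, coneAt I Y x)

/-- Iterated t-trisecant varieties: `C_X^0 X = X`, `C_X^{k+1} X = C_X (C_X^k X)`. -/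
noncomputable def CXiter (I : Set (MvPolynomial (Fin k) ℂ)) (n : ℕ) : ℕ → Set (PrSp k)
  | 0 => zeroLocus I
  | m + 1 => CXY I n (CXiter I n m)

/-- `X` is nondegenerate: it is contained in no hyperplane. -/
def Nondegenerate (X : Set (PrSp k)) : Prop :=
  ∀ l : MvPolynomial (Fin k) ℂ, l.IsHomogeneous 1 → l ≠ 0 → ¬ X ⊆ zeroLocus {l}

/-- Irreducible Zariski-closed subsets. -/
def IsIrredClosed (C : Set (PrSp k)) : Prop :=
  IsZClosed C ∧ C.Nonempty ∧
    ∀ C₁ C₂ : Set (PrSp k), IsZClosed C₁ → IsZClosed C₂ → C = C₁ ∪ C₂ → C = C₁ ∨ C = C₂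

/-- Dimension of a subset of projective space: the Krull dimension of the poset of
irreducible closed subsets of its closure. -/
noncomputable def projDim (S : Set (PrSp k)) : WithBot ℕ∞ :=
  Order.krullDim {C : Set (PrSp k) // IsIrredClosed C ∧ C ⊆ projClosure S}

/-- The space of twisted symmetric differentials `H^0(X, S^m(Ω¹_X(1)))`, in its
identification with the symmetric `m`-differentials `Ω ∈ S^m[ℂ dz_0 ⊕ ⋯ ⊕ ℂ dz_N]`
(i.e. degree-`m` homogeneous polynomials) such that `Z(Ω) ∩ T_x X` is a cone with
vertex `x` for every `x ∈ X`. -/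
noncomputable def twistedSymSpace (I : Set (MvPolynomial (Fin k) ℂ)) (m : ℕ) :
    Set (MvPolynomial (Fin k) ℂ) :=
  {Ω | Ω ∈ homogeneousSubmodule (Fin k) ℂ m ∧
    ∀ x ∈ zeroLocus I, IsConeWithVertex x (zeroLocus {Ω} ∩ embTangent I x)}

/-- The general fiber of `f` is positive dimensional: away from a proper Zariski-closed
subset of the target, the fibers are infinite. -/
def GeneralFiberPosDim {α : Type*} (f : α → PrSp k) : Prop :=
  ∃ C : Set (PrSp k), IsZClosed C ∧ C ≠ Set.univ ∧ ∀ y ∉ C, (f ⁻¹' {y}).Infinite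

end ProjGeo

open ProjGeo


namespace TTri

variable {k : ℕ}

/-- Nullstellensatz for an irreducible hypersurface. -/
lemma dvd_of_vanish {P G : MvPolynomial (Fin k) ℂ} (hP : Irreducible P)
    (h : ∀ v, eval v P = 0 → eval v G = 0) : P ∣ G := by
  have hG : G ∈ MvPolynomial.vanishingIdeal ℂ
      (MvPolynomial.zeroLocus ℂ (Ideal.span {P})) := by
    rw [MvPolynomial.mem_vanishingIdeal_iff]
    intro x hx
    have := (MvPolynomial.mem_zeroLocus_iff.mp hx) P (Ideal.mem_span_singleton_self P)
    rw [MvPolynomial.aeval_eq_eval] at this ⊢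
    exact h x this
  rw [MvPolynomial.vanishingIdeal_zeroLocus_eq_radical] at hG
  obtain ⟨n, hn⟩ := hG
  rw [Ideal.mem_span_singleton] at hn
  exact hP.prime.dvd_of_dvd_pow hn

lemma eval_smul_hom {P : MvPolynomial (Fin k) ℂ} {d : ℕ} (h : P.IsHomogeneous d) (c : ℂ)
    (v : Fin k → ℂ) : eval (c • v) P = c ^ d * eval v P := by
  rw [eval_eq', eval_eq', Finset.mul_sum]
  refine Finset.sum_congr rfl fun m hm => ?_
  have hd : ∑ i, m i = d := by
    have := h (mem_support_iff.mp hm)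
    rw [← this, Finsupp.weight_apply, Finsupp.sum_fintype _ _ (by simp)]
    simp
  simp only [Pi.smul_apply, smul_eq_mul, mul_pow, Finset.prod_mul_distrib,
    Finset.prod_pow_eq_pow_sum, hd]
  ring

/-- directional derivative -/
noncomputable def dv (v : Fin k → ℂ) (P : MvPolynomial (Fin k) ℂ) : MvPolynomial (Fin k) ℂ :=
  ∑ i, C (v i) * pderiv i P

lemma eval_dv (v a : Fin k → ℂ) (P : MvPolynomial (Fin k) ℂ) :
    eval a (dv v P) = grad P a v := by
  simp [dv, grad, mul_comm]

lemma line_eval (P : MvPolynomial (Fin k) ℂ) (a b : Fin k → ℂ) (t : ℂ) :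
    (lineRestrict P a b).eval t = eval (a + t • b) P := by
  unfold lineRestrict
  rw [← Polynomial.coe_evalRingHom, MvPolynomial.hom_eval₂]
  rw [MvPolynomial.eval, MvPolynomial.coe_eval₂Hom]
  congr 1
  · ext; simp
  · ext i; simp; ring

lemma line_mul (P Q : MvPolynomial (Fin k) ℂ) (a b : Fin k → ℂ) :
    lineRestrict (P * Q) a b = lineRestrict P a b * lineRestrict Q a b := eval₂_mul _ _

lemma line_add (P Q : MvPolynomial (Fin k) ℂ) (a b : Fin k → ℂ) :
    lineRestrict (P + Q) a b = lineRestrict P a b + lineRestrict Q a b := eval₂_add _ _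

lemma line_sub (P Q : MvPolynomial (Fin k) ℂ) (a b : Fin k → ℂ) :
    lineRestrict (P - Q) a b = lineRestrict P a b - lineRestrict Q a b := eval₂_sub _ _ _

lemma line_deriv (P : MvPolynomial (Fin k) ℂ) (a b : Fin k → ℂ) :
    Polynomial.derivative (lineRestrict P a b) = lineRestrict (dv b P) a b := by
  induction P using MvPolynomial.induction_on with
  | C c => simp [lineRestrict, dv]
  | add p q hp hq =>
    have : dv b (p + q) = dv b p + dv b q := by
      simp [dv, mul_add, Finset.sum_add_distrib]
    rw [this, line_add, line_add, Polynomial.derivative_add, hp, hq]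
  | mul_X p i hp =>
    have : dv b (p * X i) = dv b p * X i + p * C (b i) := by
      simp only [dv, Derivation.leibniz, pderiv_X, smul_eq_mul, mul_add, Finset.sum_add_distrib,
        Finset.sum_mul, Pi.single_apply]
      rw [add_comm]
      congr 1
      · exact Finset.sum_congr rfl fun j _ => by ring
      · simp [mul_comm]
    have hX : lineRestrict (X i) a b
        = Polynomial.C (a i) + Polynomial.X * Polynomial.C (b i) := eval₂_X _ _ _
    have hC : lineRestrict (C (b i)) a b = Polynomial.C (b i) := eval₂_C _ _ _
    rw [this, line_add, line_mul, line_mul, line_mul, Polynomial.derivative_mul, hp, hX, hC]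
    simp

/-- a polynomial with `f² h'' = A h' + B h` and `h(0)=h'(0)=0`, `f(0) ≠ 0` vanishes. -/
lemma ode_zero (f A B h : Polynomial ℂ) (hf : f.eval 0 ≠ 0)
    (h0 : h.eval 0 = 0) (h1 : (Polynomial.derivative h).eval 0 = 0)
    (e : f * Polynomial.derivative (Polynomial.derivative h)
      = A * Polynomial.derivative h + B * h) : h = 0 := by
  have hfX : ¬ (Polynomial.X : Polynomial ℂ) ∣ f := by
    rw [Polynomial.X_dvd_iff, Polynomial.coeff_zero_eq_eval_zero]; exact hf
  have cop : ∀ n, IsCoprime ((Polynomial.X : Polynomial ℂ) ^ n) f := fun n =>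
    ((Polynomial.irreducible_X).coprime_iff_not_dvd.mpr hfX).pow_left
  -- coefficient statement
  have key : ∀ n, Polynomial.X ^ (n+1) ∣ Polynomial.derivative h ∧ Polynomial.X ^ (n+2) ∣ h := by
    have up : ∀ (n : ℕ) (q : Polynomial ℂ), q.eval 0 = 0 →
        Polynomial.X ^ n ∣ Polynomial.derivative q → Polynomial.X ^ (n+1) ∣ q := by
      intro n q hq hd
      rw [Polynomial.X_pow_dvd_iff] at hd ⊢
      intro m hm
      rcases m with _ | m
      · rw [Polynomial.coeff_zero_eq_eval_zero]; exact hq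
      · have := hd m (by omega)
        rw [Polynomial.coeff_derivative] at this
        have h2 : (m : ℂ) + 1 ≠ 0 := by exact_mod_cast Nat.succ_ne_zero m
        exact (mul_eq_zero.mp this).resolve_right h2
    intro n
    induction n with
    | zero =>
      have a1 : Polynomial.X ^ (0+1) ∣ Polynomial.derivative h := up 0 _ h1 (by simp)
      exact ⟨a1, up 1 _ h0 (by simpa using a1)⟩
    | succ n ih =>
      have a0 : Polynomial.X ^ (n+1) ∣
          f * Polynomial.derivative (Polynomial.derivative h) := by
        rw [e]
        exact dvd_add (ih.1.mul_left _)
          (((pow_dvd_pow _ (by omega)).trans ih.2).mul_left _)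
      have a1 := up _ _ h1 ((cop (n+1)).dvd_of_dvd_mul_left a0)
      exact ⟨a1, up _ _ h0 a1⟩
  by_contra hne
  have := (key h.natDegree).2
  have := Polynomial.natDegree_le_of_dvd this hne
  simp at this

/-- linear form polynomial of the gradient -/
noncomputable def lin (F : MvPolynomial (Fin k) ℂ) (a : Fin k → ℂ) : MvPolynomial (Fin k) ℂ :=
  ∑ i, C (eval a (pderiv i F)) * X i

lemma eval_lin (F : MvPolynomial (Fin k) ℂ) (a p : Fin k → ℂ) :
    eval p (lin F a) = grad F a p := by
  simp [lin, grad]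

lemma grad_single (F : MvPolynomial (Fin k) ℂ) (a : Fin k → ℂ) (i : Fin k) :
    grad F a (Pi.single i 1) = eval a (pderiv i F) := by
  simp [grad, Pi.single_apply]

lemma lin_hom (F : MvPolynomial (Fin k) ℂ) (a : Fin k → ℂ) : (lin F a).IsHomogeneous 1 := by
  refine IsHomogeneous.sum _ _ _ fun i _ => ?_
  simpa using (isHomogeneous_C (Fin k) (eval a (pderiv i F))).mul (isHomogeneous_X ℂ i)

lemma lin_ne {F : MvPolynomial (Fin k) ℂ} {a : Fin k → ℂ} {i : Fin k}
    (h : eval a (pderiv i F) ≠ 0) : lin F a ≠ 0 := by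
  intro h0
  apply h
  rw [← grad_single, ← eval_lin, h0, map_zero]

lemma lin_irr {F : MvPolynomial (Fin k) ℂ} {a : Fin k → ℂ} {i : Fin k}
    (h : eval a (pderiv i F) ≠ 0) : Irreducible (lin F a) := by
  apply irreducible_of_totalDegree_eq_one ((lin_hom F a).totalDegree (lin_ne h))
  intro x hx
  rw [isUnit_iff_ne_zero]
  rintro rfl
  apply lin_ne h
  ext m
  simpa using hx m

/-- Hessian quadratic form at `a` as polynomial -/
noncomputable def hess (F : MvPolynomial (Fin k) ℂ) (a : Fin k → ℂ) : MvPolynomial (Fin k) ℂ :=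
  ∑ i, ∑ j, C (eval a (pderiv i (pderiv j F))) * X i * X j

lemma eval_hess (F : MvPolynomial (Fin k) ℂ) (a p : Fin k → ℂ) :
    eval p (hess F a) = eval a (dv p (dv p F)) := by
  simp only [hess, dv, map_sum, map_mul, eval_C, eval_X, Derivation.leibniz, pderiv_C,
    Finset.mul_sum, smul_eq_mul, mul_zero, add_zero]
  refine Finset.sum_congr rfl fun i _ => Finset.sum_congr rfl fun j _ => by ring

lemma dv_lin (c e : ℂ) (v w : Fin k → ℂ) (P : MvPolynomial (Fin k) ℂ) :
    dv (c • v - e • w) P = C c * dv v P - C e * dv w P := by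
  simp only [dv, Finset.mul_sum, ← Finset.sum_sub_distrib]
  refine Finset.sum_congr rfl fun i _ => ?_
  simp
  ring

lemma dv_comb (c e : ℂ) (v : Fin k → ℂ) (P Q : MvPolynomial (Fin k) ℂ) :
    dv v (C c * P - C e * Q) = C c * dv v P - C e * dv v Q := by
  simp only [dv, Finset.mul_sum, ← Finset.sum_sub_distrib]
  refine Finset.sum_congr rfl fun i _ => ?_
  simp
  ring

lemma dv_single (i : Fin k) (P : MvPolynomial (Fin k) ℂ) : dv (Pi.single i 1) P = pderiv i P := by
  simp only [dv]
  rw [Finset.sum_eq_single i]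
  · simp
  · intro b _ hb; simp [Pi.single_apply, hb]
  · simp

noncomputable def qv (F : MvPolynomial (Fin k) ℂ) (i : Fin k) (v : Fin k → ℂ) :
    MvPolynomial (Fin k) ℂ :=
  pderiv i F * pderiv i F * dv v (dv v F)
    - pderiv i F * dv v F * (dv v (pderiv i F) + pderiv i (dv v F))
    + dv v F * dv v F * pderiv i (pderiv i F)

lemma eval_qv (F : MvPolynomial (Fin k) ℂ) (i : Fin k) (v a : Fin k → ℂ) :
    eval a (qv F i v) = eval (eval a (pderiv i F) • v - (grad F a v) • Pi.single i 1)
      (hess F a) := by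
  rw [eval_hess, dv_lin, dv_lin, dv_comb, dv_comb, dv_single, dv_single, dv_single]
  simp only [qv, map_add, map_sub, map_mul, eval_C, ← eval_dv v a F]
  ring

variable {F : MvPolynomial (Fin k) ℂ} {d : ℕ}

lemma euler (hF : F.IsHomogeneous d) {a : Fin k → ℂ} (h0 : eval a F = 0) : grad F a a = 0 := by
  have := congrArg (eval a) hF.sum_X_mul_pderiv
  simp [h0] at this
  simp only [grad, LinearMap.sum_apply, LinearMap.smul_apply, LinearMap.proj_apply, smul_eq_mul]
  rw [← this]
  exact Finset.sum_congr rfl fun i _ => by ring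

lemma exists_pderiv (hd : 3 ≤ d) (hF : F.IsHomogeneous d) (hirr : Irreducible F) :
    ∃ i, pderiv i F ≠ 0 := by
  by_contra! h
  have := hF.sum_X_mul_pderiv
  simp [h] at this
  rcases this with h | h
  · omega
  · exact hirr.ne_zero h

lemma not_dvd_pderiv (hd : 3 ≤ d) (hF : F.IsHomogeneous d) (hirr : Irreducible F) {i : Fin k}
    (hi : pderiv i F ≠ 0) : ¬ F ∣ pderiv i F := by
  rintro ⟨g, hg⟩
  have hg0 : g ≠ 0 := by rintro rfl; simp [hi] at hg
  have h1 := (hF.pderiv (i := i)).totalDegree hi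
  rw [hg, totalDegree_mul_of_isDomain hirr.ne_zero hg0, hF.totalDegree hirr.ne_zero] at h1
  omega

lemma not_lin_dvd (hd : 3 ≤ d) (hF : F.IsHomogeneous d) (hirr : Irreducible F) {i : Fin k}
    {a : Fin k → ℂ} (h : eval a (pderiv i F) ≠ 0) : ¬ lin F a ∣ F := by
  intro hdv
  have hass := (lin_irr h).associated_of_dvd hirr hdv
  obtain ⟨g, hg⟩ := hass.symm.dvd
  have hg0 : g ≠ 0 := by rintro rfl; simp [lin_ne h] at hg
  have h1 := (lin_hom F a).totalDegree (lin_ne h)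
  rw [hg, totalDegree_mul_of_isDomain hirr.ne_zero hg0, hF.totalDegree hirr.ne_zero] at h1
  omega

lemma exists_qv (hd : 3 ≤ d) (hF : F.IsHomogeneous d) (hirr : Irreducible F) {i : Fin k}
    (hi : pderiv i F ≠ 0) : ∃ v, ¬ F ∣ qv F i v := by
  by_contra! hall
  obtain ⟨a, ha0, hai⟩ : ∃ a, eval a F = 0 ∧ eval a (pderiv i F) ≠ 0 := by
    by_contra! h
    exact not_dvd_pderiv hd hF hirr hi (dvd_of_vanish hirr h)
  apply not_lin_dvd hd hF hirr hai
  apply dvd_of_vanish (lin_irr hai)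
  intro y hy
  rw [eval_lin] at hy
  set v := y - a with hv
  have hvT : grad F a v = 0 := by rw [hv, map_sub, hy, euler hF ha0, sub_zero]
  obtain ⟨B, hB⟩ := hall v
  have hz : lineRestrict F a v = 0 := by
    refine ode_zero (lineRestrict (pderiv i F) a v * lineRestrict (pderiv i F) a v)
      (lineRestrict (pderiv i F) a v *
        (lineRestrict (dv v (pderiv i F)) a v + lineRestrict (pderiv i (dv v F)) a v)
        - lineRestrict (dv v F) a v * lineRestrict (pderiv i (pderiv i F)) a v)
      (lineRestrict B a v) _ ?_ ?_ ?_ ?_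
    · simp [line_eval, hai]
    · simp [line_eval, ha0]
    · rw [line_deriv, line_eval]; simp [eval_dv, hvT]
    · rw [line_deriv, line_deriv]
      have := congrArg (fun P => lineRestrict P a v) hB
      simp only [qv, line_add, line_sub, line_mul] at this
      linear_combination this
  have := line_eval F a v 1
  rw [hz] at this
  simpa [hv] using this.symm

/-- If `F` restricted to the line through `a` in a tangent direction `p` has contact of order
exactly two, there is another intersection point. -/
lemma exists_root (hd : 3 ≤ d) (hF : F.IsHomogeneous d) {a p : Fin k → ℂ}
    (h0 : eval a F = 0) (h1 : grad F a p = 0) (h2 : eval p (hess F a) ≠ 0)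
    (hp : eval p F ≠ 0) : ∃ t : ℂ, t ≠ 0 ∧ eval (a + t • p) F = 0 := by
  set h := lineRestrict F a p with hh
  have e0 : h.coeff 0 = 0 := by
    rw [Polynomial.coeff_zero_eq_eval_zero, line_eval]; simp [h0]
  have e1 : h.coeff 1 = 0 := by
    have : (Polynomial.derivative h).coeff 0 = 0 := by
      rw [line_deriv, Polynomial.coeff_zero_eq_eval_zero, line_eval]; simp [eval_dv, h1]
    simpa [Polynomial.coeff_derivative] using this
  have e2 : h.coeff 2 ≠ 0 := by
    intro hc
    apply h2
    rw [eval_hess]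
    have : (Polynomial.derivative (Polynomial.derivative h)).coeff 0 = 0 := by
      simp [Polynomial.coeff_derivative, hc]
    rw [line_deriv, line_deriv, Polynomial.coeff_zero_eq_eval_zero, line_eval] at this
    simpa using this
  obtain ⟨g, hg⟩ : Polynomial.X ^ 2 ∣ h := by
    rw [Polynomial.X_pow_dvd_iff]
    intro m hm
    interval_cases m <;> assumption
  have hg0 : g.coeff 0 ≠ 0 := by
    rw [hg, show 2 = 0 + 2 from rfl, Polynomial.coeff_X_pow_mul] at e2; exact e2
  by_cases hdeg : g.degree = 0
  · exfalso
    apply hp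
    obtain ⟨c, hc⟩ : ∃ c, g = Polynomial.C c := ⟨_, Polynomial.eq_C_of_degree_eq_zero hdeg⟩
    have hr : lineRestrict F p a = Polynomial.C c * Polynomial.X ^ (d - 2) := by
      apply Polynomial.eq_of_infinite_eval_eq
      refine Set.Infinite.mono (s := {(0 : ℂ)}ᶜ) ?_ (Set.finite_singleton _).infinite_compl
      intro s hs
      have hs : s ≠ 0 := hs
      have e : p + s • a = s • (a + s⁻¹ • p) := by
        rw [smul_add, smul_smul, mul_inv_cancel₀ hs, one_smul, add_comm]
      simp only [Set.mem_ofPred_eq]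
      rw [line_eval, e, eval_smul_hom hF, ← line_eval, ← hh, hg, hc]
      simp only [Polynomial.eval_mul, Polynomial.eval_pow, Polynomial.eval_X, Polynomial.eval_C]
      obtain ⟨m, rfl⟩ : ∃ m, d = m + 2 := ⟨d - 2, by omega⟩
      simp only [Nat.add_sub_cancel]
      field_simp
      ring
    have := line_eval F p a 0
    rw [hr] at this
    have hd2 : d - 2 ≠ 0 := by omega
    simpa [hd2] using this.symm
  · obtain ⟨t, ht⟩ := IsAlgClosed.exists_root g hdeg
    refine ⟨t, ?_, ?_⟩
    · rintro rfl
      apply hg0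
      rw [Polynomial.coeff_zero_eq_eval_zero]; exact ht
    · rw [← line_eval, ← hh, hg, Polynomial.eval_mul, ht.eq_zero, mul_zero]

lemma grad_smul (hF : F.IsHomogeneous d) (c : ℂ) (a : Fin k → ℂ) :
    grad F (c • a) = c ^ (d - 1) • grad F a := by
  simp only [grad, Finset.smul_sum, smul_smul, eval_smul_hom hF.pderiv]

lemma tangentCone_single (a : Fin k → ℂ) : tangentCone {F} a = LinearMap.ker (grad F a) := by
  simp [tangentCone]

lemma ker_smul (hF : F.IsHomogeneous d) {c : ℂ} (hc : c ≠ 0) (a : Fin k → ℂ) :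
    LinearMap.ker (grad F (c • a)) = LinearMap.ker (grad F a) := by
  rw [grad_smul hF, LinearMap.ker_smul _ _ (pow_ne_zero _ hc)]

lemma mem_zeroLocus_mk (hF : F.IsHomogeneous d) {y : Fin k → ℂ} (hy : y ≠ 0)
    (h : eval y F = 0) : Projectivization.mk ℂ y hy ∈ zeroLocus {F} := by
  intro f hf v hv
  rw [Set.mem_singleton_iff] at hf
  subst hf
  rw [Projectivization.submodule_mk, Submodule.mem_span_singleton] at hv
  obtain ⟨c, rfl⟩ := hv
  rw [eval_smul_hom hF, h, mul_zero]

/-- geometric step -/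
lemma mem_cone {N : ℕ} (hN : 2 ≤ N) (hd : 3 ≤ d) {F : MvPolynomial (Fin (N + 1)) ℂ}
    (hF : F.IsHomogeneous d) {i : Fin (N + 1)}
    {a p : Fin (N + 1) → ℂ} (hi : eval a (pderiv i F) ≠ 0)
    (h0 : eval a F = 0) (h1 : grad F a p = 0) (h2 : eval p (hess F a) ≠ 0)
    (hp : eval p F ≠ 0) :
    ∃ hp0 : p ≠ 0, Projectivization.mk ℂ p hp0 ∈
      (⋃ x ∈ {x ∈ zeroLocus {F} | SmoothAt {F} (N - 1) x}, coneAt {F} (zeroLocus {F}) x) := by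
  have hz : ∀ (P : MvPolynomial (Fin (N + 1)) ℂ) (e : ℕ), P.IsHomogeneous e → e ≠ 0 →
      eval 0 P = 0 := by
    intro P e hP he
    have := eval_smul_hom hP 0 0
    simpa [he] using this
  have hp0 : p ≠ 0 := by
    rintro rfl; exact hp (hz F d hF (by omega))
  have ha0 : a ≠ 0 := by
    rintro rfl; exact hi (hz _ _ hF.pderiv (by omega))
  obtain ⟨t, ht, hroot⟩ := exists_root hd hF h0 h1 h2 hp
  have hindep : ∀ c : ℂ, p ≠ c • a := by
    rintro c rfl
    apply hp; rw [eval_smul_hom hF, h0, mul_zero]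
  have hpe : ∀ y, y = a + t • p → p = t⁻¹ • (y - a) := by
    rintro y rfl
    rw [add_sub_cancel_left, smul_smul, inv_mul_cancel₀ ht, one_smul]
  have hy0 : a + t • p ≠ 0 := by
    intro h
    apply hindep (-t⁻¹)
    have := hpe _ rfl
    rw [h, zero_sub] at this
    rw [this]; simp
  have hgne : grad F a ≠ 0 := by
    intro h; apply hi; rw [← grad_single, h]; rfl
  refine ⟨hp0, ?_⟩
  simp only [Set.mem_iUnion, coneAt]
  refine ⟨Projectivization.mk ℂ a ha0, ⟨mem_zeroLocus_mk hF ha0 h0, ?_⟩,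
    Projectivization.mk ℂ (a + t • p) hy0, ⟨⟨mem_zeroLocus_mk hF hy0 hroot, ?_⟩, ?_⟩, ?_⟩
  · intro v hv hv0
    rw [Projectivization.submodule_mk, Submodule.mem_span_singleton] at hv
    obtain ⟨c, rfl⟩ := hv
    have hc : c ≠ 0 := by rintro rfl; simp at hv0
    rw [tangentCone_single, ker_smul hF hc]
    have := Module.Dual.finrank_ker_add_one_of_ne_zero hgne
    simp only [Module.finrank_fin_fun] at this
    omega
  · obtain ⟨c, hc⟩ := Projectivization.exists_smul_eq_mk_rep ℂ a ha0
    simp only [embTangent, Set.mem_ofPred_eq]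
    rw [← hc, tangentCone_single, Units.smul_def, ker_smul hF c.ne_zero,
      Projectivization.submodule_mk, Submodule.span_singleton_le_iff_mem, LinearMap.mem_ker,
      map_add, map_smul, h1, euler hF h0]
    simp
  · intro h
    rw [Set.mem_singleton_iff, Projectivization.mk_eq_mk_iff'] at h
    obtain ⟨c, hc⟩ := h
    apply hindep (t⁻¹ * (c - 1))
    rw [hpe _ rfl, ← hc, mul_smul, sub_smul, one_smul]
  · simp only [chord, Set.mem_ofPred_eq, Projectivization.submodule_mk]
    rw [Submodule.span_singleton_le_iff_mem]
    have hpp := hpe _ rfl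
    generalize a + t • p = y at hpp
    rw [hpp]
    refine Submodule.smul_mem _ _ (Submodule.sub_mem _ ?_ ?_)
    · exact Submodule.mem_sup_right (Submodule.mem_span_singleton_self _)
    · exact Submodule.mem_sup_left (Submodule.mem_span_singleton_self _)

lemma vanish_zero (hd : 3 ≤ d) (hF : F.IsHomogeneous d) (hirr : Irreducible F) {i : Fin k}
    (hi : pderiv i F ≠ 0) {v : Fin k → ℂ} (hv : ¬ F ∣ qv F i v) (n : ℕ) :
    ∀ G : MvPolynomial (Fin k) ℂ, G.totalDegree < n →
    (∀ a, eval a F = 0 → eval a (pderiv i F) ≠ 0 → eval a (qv F i v) ≠ 0 → lin F a ∣ G) →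
    G = 0 := by
  induction n with
  | zero => intro G h; omega
  | succ n ih =>
    intro G hn hG
    have hdv : F ∣ (pderiv i F * qv F i v) * G := by
      apply dvd_of_vanish hirr
      intro a ha
      by_contra hne
      simp only [map_mul, mul_eq_zero, not_or] at hne
      obtain ⟨⟨h1, h2⟩, h3⟩ := hne
      obtain ⟨g, hg⟩ := hG a ha h1 h2
      apply h3
      rw [hg, map_mul, eval_lin, euler hF ha, zero_mul]
    have hFG : F ∣ G := by
      rcases hirr.prime.dvd_or_dvd hdv with h | h
      · rcases hirr.prime.dvd_or_dvd h with h | h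
        · exact absurd h (not_dvd_pderiv hd hF hirr hi)
        · exact absurd h hv
      · exact h
    obtain ⟨G', rfl⟩ := hFG
    by_cases h0 : G' = 0
    · simp [h0]
    rw [totalDegree_mul_of_isDomain hirr.ne_zero h0, hF.totalDegree hirr.ne_zero] at hn
    refine absurd (ih G' (by omega) ?_) h0
    intro a ha h1 h2
    exact ((lin_irr h1).prime.dvd_or_dvd (hG a ha h1 h2)).resolve_left
      (not_lin_dvd hd hF hirr h1)

end TTri

open TTri in
theorem statement_8 (N : ℕ) (hN : 2 ≤ N) (d : ℕ) (hd : 3 ≤ d)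
    (F : MvPolynomial (Fin (N + 1)) ℂ) (hF : F.IsHomogeneous d) (hirr : Irreducible F)
    (hnd : Nondegenerate (zeroLocus {F})) :
    CXY {F} (N - 1) (zeroLocus {F}) = Set.univ := by
  obtain ⟨i, hi⟩ := exists_pderiv hd hF hirr
  obtain ⟨v, hv⟩ := exists_qv hd hF hirr hi
  rw [Set.eq_univ_iff_forall]
  intro P G hG w _
  suffices h : G = 0 by rw [h, map_zero]
  refine vanish_zero hd hF hirr hi hv _ G (Nat.lt_succ_self _) ?_
  intro a ha h1 h2
  have hdv : lin F a ∣ (F * hess F a) * G := by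
    apply dvd_of_vanish (lin_irr h1)
    intro p hp
    rw [eval_lin] at hp
    by_contra hne
    simp only [map_mul, mul_eq_zero, not_or] at hne
    obtain ⟨⟨e1, e2⟩, e3⟩ := hne
    obtain ⟨hp0, hmem⟩ := mem_cone hN hd hF h1 ha hp e2 e1
    apply e3
    refine hG _ hmem p ?_
    rw [Projectivization.submodule_mk]
    exact Submodule.mem_span_singleton_self _
  rcases (lin_irr h1).prime.dvd_or_dvd hdv with h | h
  · rcases (lin_irr h1).prime.dvd_or_dvd h with h | h
    · exact absurd h (not_lin_dvd hd hF hirr h1)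
    · exfalso
      apply h2
      obtain ⟨g, hg⟩ := h
      rw [eval_qv, hg, map_mul, eval_lin, map_sub, map_smul, map_smul, grad_single]
      simp [mul_comm]
  · exact h
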